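/- arXiv:2411.03830 — 2 statements merged into one kernel-verified Lean document; each statement's English description precedes it below -/
import Mathlib

section
/- Let 0 < β < 1 and 1 ≤ q < ∞. A locally integrable function f on ℝ^n satisfies ‖f‖_{Lip_{β,q}} := sup_Q |Q|^{−β/n} ( |Q|^{-1} ∫_Q |f(x) − f_Q|^q dx )^{1/q} < ∞ (supremum over all cubes Q) if and only if f coincides almost everywhere with a function in Lip_β(ℝ^n); moreover the norms are equivalent: there exist constants c, C > 0 depending only on n, β, q such that c ‖f‖_{Lip_β} ≤ ‖f‖_{Lip_{β,q}} ≤ C ‖f‖_{Lip_β}. -/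
open MeasureTheory ENNReal Metric

noncomputable section

/-- The (closed) cube centered at `x` with side length `r`. -/
def cube {n : ℕ} (x : EuclideanSpace ℝ (Fin n)) (r : ℝ) : Set (EuclideanSpace ℝ (Fin n)) :=
  {y | ∀ i, |y i - x i| ≤ r / 2}

/-- The average `f_Q = |Q|⁻¹ ∫_Q f` of `f` over a set `Q`. -/
def setAvg {n : ℕ} (Q : Set (EuclideanSpace ℝ (Fin n))) (f : EuclideanSpace ℝ (Fin n) → ℝ) : ℝ :=
  (volume Q).toReal⁻¹ * ∫ y in Q, f y

/-- Slice norm of an `ℝ≥0∞`-valued function. -/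
def sliceNormE {n : ℕ} (p q t : ℝ) (g : EuclideanSpace ℝ (Fin n) → ℝ≥0∞) : ℝ≥0∞ :=
  (∫⁻ x, ((volume (cube x t))⁻¹ * ∫⁻ y in cube x t, g y ^ p) ^ (q / p)) ^ (1 / q)

/-- The slice space norm `‖f‖_{(E_p^q)_t}`. -/
def sliceNorm {n : ℕ} (p q t : ℝ) (f : EuclideanSpace ℝ (Fin n) → ℝ) : ℝ≥0∞ :=
  sliceNormE p q t fun y => ENNReal.ofReal |f y|

/-- Membership in the slice space `(E_p^q)_t(ℝⁿ)`. -/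
def MemSlice {n : ℕ} (p q t : ℝ) (f : EuclideanSpace ℝ (Fin n) → ℝ) : Prop :=
  Measurable f ∧ sliceNorm p q t f ≠ ∞

/-- The BMO seminorm, as a supremum over all cubes. -/
def bmoNorm {n : ℕ} (b : EuclideanSpace ℝ (Fin n) → ℝ) : ℝ≥0∞ :=
  ⨆ (x : EuclideanSpace ℝ (Fin n)) (r : ℝ) (_ : 0 < r),
    (volume (cube x r))⁻¹ * ∫⁻ y in cube x r, ENNReal.ofReal |b y - setAvg (cube x r) b|

/-- Membership in `BMO(ℝⁿ)`. -/
def MemBMO {n : ℕ} (b : EuclideanSpace ℝ (Fin n) → ℝ) : Prop :=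
  LocallyIntegrable b volume ∧ bmoNorm b ≠ ∞

/-- `Ω` is homogeneous of degree zero. -/
def HomogZero {n : ℕ} (Ω : EuclideanSpace ℝ (Fin n) → ℝ) : Prop :=
  ∀ lam : ℝ, 0 < lam → ∀ x : EuclideanSpace ℝ (Fin n), x ≠ 0 → Ω (lam • x) = Ω x

/-- `Ω` has mean value zero on the unit sphere. -/
def MeanZeroOnSphere {n : ℕ} (Ω : EuclideanSpace ℝ (Fin n) → ℝ) : Prop :=
  ∫ x : sphere (0 : EuclideanSpace ℝ (Fin n)) 1, Ω x
    ∂((volume : Measure (EuclideanSpace ℝ (Fin n))).toSphere) = 0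

/-- The fractional integral operator with rough kernel,
`T_{Ω,α} f (x) = ∫ Ω(x-y) |x-y|^{α-n} f(y) dy`. -/
def fracInt {n : ℕ} (Ω : EuclideanSpace ℝ (Fin n) → ℝ) (α : ℝ)
    (f : EuclideanSpace ℝ (Fin n) → ℝ) (x : EuclideanSpace ℝ (Fin n)) : ℝ :=
  ∫ y, Ω (x - y) * ‖x - y‖ ^ (α - n) * f y

/-- The commutator `[b, T_{Ω,α}] f = b ⬝ T_{Ω,α} f - T_{Ω,α}(b f)`. -/
def commutatorOp {n : ℕ} (Ω : EuclideanSpace ℝ (Fin n) → ℝ) (α : ℝ)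
    (b f : EuclideanSpace ℝ (Fin n) → ℝ) : EuclideanSpace ℝ (Fin n) → ℝ :=
  fun x => b x * fracInt Ω α f x - fracInt Ω α (fun y => b y * f y) x

/-- The fractional maximal operator `M_γ` (over cubes); `γ = 0` gives the
Hardy–Littlewood maximal operator. -/
def fracMax {n : ℕ} (γ : ℝ) (f : EuclideanSpace ℝ (Fin n) → ℝ)
    (x : EuclideanSpace ℝ (Fin n)) : ℝ≥0∞ :=
  ⨆ (z : EuclideanSpace ℝ (Fin n)) (r : ℝ) (_ : 0 < r) (_ : x ∈ cube z r),
    volume (cube z r) ^ (γ / n - 1) * ∫⁻ y in cube z r, ENNReal.ofReal |f y|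

/-- The Fefferman–Stein sharp maximal operator `M^♯`. -/
def sharpMax {n : ℕ} (f : EuclideanSpace ℝ (Fin n) → ℝ)
    (x : EuclideanSpace ℝ (Fin n)) : ℝ≥0∞ :=
  ⨆ (z : EuclideanSpace ℝ (Fin n)) (r : ℝ) (_ : 0 < r) (_ : x ∈ cube z r),
    (volume (cube z r))⁻¹ * ∫⁻ y in cube z r, ENNReal.ofReal |f y - setAvg (cube z r) f|

/-- The `L^p` norm. -/
def lpNorm {n : ℕ} (p : ℝ) (f : EuclideanSpace ℝ (Fin n) → ℝ) : ℝ≥0∞ :=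
  (∫⁻ x, ENNReal.ofReal |f x| ^ p) ^ (1 / p)

/-- The set of admissible Hölder–Lipschitz constants of order `β` for `b`. -/
def LipConstSet {n : ℕ} (β : ℝ) (b : EuclideanSpace ℝ (Fin n) → ℝ) : Set ℝ :=
  {C : ℝ | ∀ x y, |b x - b y| ≤ C * dist x y ^ β}

/-- Membership in the Lipschitz space `Lip_β(ℝⁿ)`. -/
def MemLip {n : ℕ} (β : ℝ) (b : EuclideanSpace ℝ (Fin n) → ℝ) : Prop :=
  (LipConstSet β b).Nonempty

/-- The `Lip_β` norm: the least admissible constant. -/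
def lipNorm {n : ℕ} (β : ℝ) (b : EuclideanSpace ℝ (Fin n) → ℝ) : ℝ :=
  sInf (LipConstSet β b)

/-- The integral Lipschitz norm `‖f‖_{Lip_{β,q}}`. -/
def lipIntNorm {n : ℕ} (β q : ℝ) (f : EuclideanSpace ℝ (Fin n) → ℝ) : ℝ≥0∞ :=
  ⨆ (x : EuclideanSpace ℝ (Fin n)) (r : ℝ) (_ : 0 < r),
    volume (cube x r) ^ (-(β / n)) *
      ((volume (cube x r))⁻¹ *
        ∫⁻ y in cube x r, ENNReal.ofReal |f y - setAvg (cube x r) f| ^ q) ^ (1 / q)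

lemma cube_eq_preimage {n : ℕ} (x : EuclideanSpace ℝ (Fin n)) {r : ℝ} (hr : 0 ≤ r) :
    cube x r = WithLp.ofLp ⁻¹' closedBall (WithLp.ofLp x) (r / 2) := by
  ext y
  simp [cube, dist_pi_le_iff (by positivity : 0 ≤ r / 2), Real.dist_eq]

lemma measurableEmbedding_ofLp (n : ℕ) :
    MeasurableEmbedding (WithLp.ofLp : EuclideanSpace ℝ (Fin n) → Fin n → ℝ) :=
  (MeasurableEquiv.toLp 2 (Fin n → ℝ)).symm.measurableEmbedding

lemma volume_cube {n : ℕ} (x : EuclideanSpace ℝ (Fin n)) {r : ℝ} (hr : 0 ≤ r) :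
    volume (cube x r) = ENNReal.ofReal (r ^ n) := by
  rw [cube_eq_preimage x hr, (PiLp.volume_preserving_ofLp (Fin n)).measure_preimage_emb
    (measurableEmbedding_ofLp n), Real.volume_pi_closedBall _ (by positivity)]
  simp [mul_div_cancel₀]

lemma volume_cube_rpow {n : ℕ} (hn : 1 ≤ n) (β : ℝ) (x : EuclideanSpace ℝ (Fin n)) {r : ℝ}
    (hr : 0 < r) : volume (cube x r) ^ (-(β / n)) = ENNReal.ofReal (r ^ (-β)) := by
  rw [volume_cube x hr.le, ENNReal.ofReal_rpow_of_pos (by positivity), ← Real.rpow_natCast,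
    ← Real.rpow_mul hr.le]
  congr 2
  field_simp

lemma isCompact_cube {n : ℕ} (x : EuclideanSpace ℝ (Fin n)) {r : ℝ} (hr : 0 ≤ r) :
    IsCompact (cube x r) := by
  rw [cube_eq_preimage x hr]
  exact (PiLp.homeomorph 2 (fun _ : Fin n => ℝ)).isCompact_preimage.2 (isCompact_closedBall _ _)

lemma setAvg_cube_eq_average {n : ℕ} (f : EuclideanSpace ℝ (Fin n) → ℝ)
    (x : EuclideanSpace ℝ (Fin n)) {r : ℝ} (hr : 0 ≤ r) :
    setAvg (cube x r) f =
      ⨍ y in closedBall (WithLp.ofLp x) (r / 2), f (WithLp.toLp 2 y) := by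
  have hp := PiLp.volume_preserving_ofLp (Fin n)
  rw [setAverage_eq, setAvg, cube_eq_preimage x hr,
    hp.measure_preimage_emb (measurableEmbedding_ofLp n),
    ← hp.setIntegral_preimage_emb (measurableEmbedding_ofLp n)]
  rfl

/-- Lebesgue differentiation along cubes. -/
lemma ae_tendsto_setAvg_cube {n : ℕ} {f : EuclideanSpace ℝ (Fin n) → ℝ}
    (hf : LocallyIntegrable f volume) :
    ∀ᵐ x, ∀ δ : ℕ → ℝ, Filter.Tendsto δ Filter.atTop (nhdsWithin 0 (Set.Ioi 0)) →
      Filter.Tendsto (fun k => setAvg (cube x (δ k)) f) Filter.atTop (nhds (f x)) := by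
  have hp := PiLp.volume_preserving_ofLp (Fin n)
  have hloc : LocallyIntegrable (fun y : Fin n → ℝ => f (WithLp.toLp 2 y)) volume := by
    have h := locallyIntegrable_map_homeomorph (PiLp.homeomorph 2 (fun _ : Fin n => ℝ)).symm
      (f := f) (μ := volume)
    refine h.1 ?_
    have hm : Measure.map (PiLp.homeomorph 2 (fun _ : Fin n => ℝ)).symm volume = volume :=
      (PiLp.volume_preserving_toLp (Fin n)).map_eq
    rwa [hm]
  have h := hp.quasiMeasurePreserving.ae
    (IsUnifLocDoublingMeasure.ae_tendsto_average volume hloc 1)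
  filter_upwards [h] with x hx δ hδ
  have hδ' : Filter.Tendsto (fun k => δ k / 2) Filter.atTop (nhdsWithin 0 (Set.Ioi 0)) := by
    rw [tendsto_nhdsWithin_iff] at hδ ⊢
    refine ⟨by simpa using hδ.1.div_const 2, hδ.2.mono fun k hk => ?_⟩
    simp only [Set.mem_Ioi] at hk ⊢
    positivity
  have hpos : ∀ᶠ k in Filter.atTop, 0 < δ k := (tendsto_nhdsWithin_iff.1 hδ).2
  have := hx (fun _ => WithLp.ofLp x) (fun k => δ k / 2) hδ' (hpos.mono fun k hk => by
    simp only [one_mul, mem_closedBall, dist_self]; positivity)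
  refine this.congr' (hpos.mono fun k hk => ?_)
  exact (setAvg_cube_eq_average f x hk.le).symm

lemma setIntegral_abs_sub_setAvg_le {n : ℕ} (hn : 1 ≤ n) {β q : ℝ} (hq : 1 ≤ q)
    {f : EuclideanSpace ℝ (Fin n) → ℝ} (hf : LocallyIntegrable f volume)
    (hN : lipIntNorm β q f ≠ ∞) (x : EuclideanSpace ℝ (Fin n)) {r : ℝ} (hr : 0 < r) :
    ∫ y in cube x r, |f y - setAvg (cube x r) f| ≤ (lipIntNorm β q f).toReal * r ^ β * r ^ n := by
  set c := setAvg (cube x r) f with hc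
  have hV : volume (cube x r) = ENNReal.ofReal (r ^ n) := volume_cube x hr.le
  have hV0 : volume (cube x r) ≠ 0 := by rw [hV]; simp; positivity
  have hVt : volume (cube x r) ≠ ∞ := by rw [hV]; simp
  have hint : IntegrableOn (fun y => f y - c) (cube x r) :=
    (hf.integrableOn_isCompact (isCompact_cube x hr.le)).sub
      (integrableOn_const hVt)
  let μ : Measure (EuclideanSpace ℝ (Fin n)) :=
    (volume (cube x r))⁻¹ • volume.restrict (cube x r)
  have : IsProbabilityMeasure μ := ⟨by
    simp [μ, ENNReal.inv_mul_cancel hV0 hVt]⟩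
  have hle : volume (cube x r) ^ (-(β / n)) * ((volume (cube x r))⁻¹ *
      ∫⁻ y in cube x r, ENNReal.ofReal |f y - c| ^ q) ^ (1 / q) ≤ lipIntNorm β q f := by
    unfold lipIntNorm
    exact le_iSup_of_le x (le_iSup_of_le r (le_iSup_of_le hr le_rfl))
  have hH := eLpNorm'_le_eLpNorm'_of_exponent_le (f := fun y => f y - c) one_pos hq μ
    (hint.1.smul_measure _)
  simp only [eLpNorm', μ, lintegral_smul_measure, smul_eq_mul, ENNReal.rpow_one, one_div_one,
    ← ofReal_norm, Real.norm_eq_abs] at hH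
  have hb := (mul_le_mul_right hH (volume (cube x r) ^ (-(β / n)))).trans hle
  have hreal := ofReal_integral_norm_eq_lintegral_enorm hint
  simp only [← ofReal_norm, Real.norm_eq_abs] at hreal
  rw [← hreal, volume_cube_rpow hn β x hr, hV] at hb
  have hb' := ENNReal.toReal_mono hN hb
  have hI : 0 ≤ ∫ y in cube x r, |f y - c| := integral_nonneg fun _ => abs_nonneg _
  rw [ENNReal.toReal_mul, ENNReal.toReal_mul, ENNReal.toReal_inv,
    ENNReal.toReal_ofReal (by positivity), ENNReal.toReal_ofReal (by positivity),
    ENNReal.toReal_ofReal hI, Real.rpow_neg hr.le,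
    inv_mul_le_iff₀ (by positivity), inv_mul_le_iff₀ (by positivity)] at hb'
  linarith

lemma cube_subset_cube {n : ℕ} {x y : EuclideanSpace ℝ (Fin n)} {r s : ℝ}
    (h : dist x y + r / 2 ≤ s / 2) : cube x r ⊆ cube y s := by
  intro z hz i
  have h1 := PiLp.norm_apply_le (x - y) i
  rw [← dist_eq_norm, Real.norm_eq_abs] at h1
  have h2 := hz i
  have h3 := abs_add_le (z i - x i) (x i - y i)
  simp only [sub_add_sub_cancel, PiLp.sub_apply] at h1 h3
  linarith

lemma abs_setAvg_sub_le {n : ℕ} {f : EuclideanSpace ℝ (Fin n) → ℝ}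
    (hf : LocallyIntegrable f volume) (x : EuclideanSpace ℝ (Fin n)) {r : ℝ} (hr : 0 < r) (c : ℝ) :
    |setAvg (cube x r) f - c| ≤ (r ^ n)⁻¹ * ∫ y in cube x r, |f y - c| := by
  have hV : volume (cube x r) = ENNReal.ofReal (r ^ n) := volume_cube x hr.le
  have hVr : (volume (cube x r)).toReal = r ^ n := by
    rw [hV, ENNReal.toReal_ofReal (by positivity)]
  have hint := hf.integrableOn_isCompact (isCompact_cube x hr.le)
  have hVt : volume (cube x r) ≠ ∞ := by rw [hV]; simp
  have : setAvg (cube x r) f - c = (r ^ n)⁻¹ * ∫ y in cube x r, (f y - c) := by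
    rw [integral_sub hint (integrableOn_const hVt), setIntegral_const, setAvg, measureReal_def, hVr]
    have : r ^ n ≠ 0 := by positivity
    simp only [smul_eq_mul]
    field_simp
  rw [this, abs_mul, abs_of_nonneg (by positivity : 0 ≤ (r ^ n)⁻¹)]
  gcongr
  exact abs_integral_le_integral_abs

lemma abs_setAvg_sub_setAvg_le {n : ℕ} (hn : 1 ≤ n) {β q : ℝ} (hq : 1 ≤ q)
    {f : EuclideanSpace ℝ (Fin n) → ℝ} (hf : LocallyIntegrable f volume)
    (hN : lipIntNorm β q f ≠ ∞) {x y : EuclideanSpace ℝ (Fin n)} {r s : ℝ} (hr : 0 < r)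
    (hs : 0 < s) (hsub : cube x r ⊆ cube y s) :
    |setAvg (cube x r) f - setAvg (cube y s) f| ≤
      (s / r) ^ n * ((lipIntNorm β q f).toReal * s ^ β) := by
  set c := setAvg (cube y s) f with hc
  have hVt : volume (cube y s) ≠ ∞ := by rw [volume_cube y hs.le]; simp
  have hint : IntegrableOn (fun z => |f z - c|) (cube y s) :=
    ((hf.integrableOn_isCompact (isCompact_cube y hs.le)).sub (integrableOn_const hVt)).abs
  calc |setAvg (cube x r) f - c| ≤ (r ^ n)⁻¹ * ∫ z in cube x r, |f z - c| :=
        abs_setAvg_sub_le hf x hr c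
    _ ≤ (r ^ n)⁻¹ * ∫ z in cube y s, |f z - c| := by
        refine mul_le_mul_of_nonneg_left ?_ (by positivity)
        exact setIntegral_mono_set hint (Filter.Eventually.of_forall fun _ => abs_nonneg _)
          hsub.eventuallyLE
    _ ≤ (r ^ n)⁻¹ * ((lipIntNorm β q f).toReal * s ^ β * s ^ n) := by
        gcongr
        exact setIntegral_abs_sub_setAvg_le hn hq hf hN y hs
    _ = _ := by rw [div_pow]; field_simp

lemma abs_setAvg_sub_limit_le {n : ℕ} (hn : 1 ≤ n) {β q : ℝ} (hβ : 0 < β) (hq : 1 ≤ q)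
    {f : EuclideanSpace ℝ (Fin n) → ℝ} (hf : LocallyIntegrable f volume)
    (hN : lipIntNorm β q f ≠ ∞) {x : EuclideanSpace ℝ (Fin n)}
    (hx : ∀ δ : ℕ → ℝ, Filter.Tendsto δ Filter.atTop (nhdsWithin 0 (Set.Ioi 0)) →
      Filter.Tendsto (fun k => setAvg (cube x (δ k)) f) Filter.atTop (nhds (f x)))
    {r : ℝ} (hr : 0 < r) :
    |setAvg (cube x r) f - f x| ≤
      2 ^ n * ((lipIntNorm β q f).toReal * r ^ β) / (1 - (1 / 2 : ℝ) ^ β) := by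
  have hlt : (1 / 2 : ℝ) ^ β < 1 := Real.rpow_lt_one (by norm_num) (by norm_num) hβ
  have hδ : Filter.Tendsto (fun k : ℕ => r * (1 / 2 : ℝ) ^ k) Filter.atTop
      (nhdsWithin 0 (Set.Ioi 0)) := by
    refine tendsto_nhdsWithin_iff.2 ⟨?_, Filter.Eventually.of_forall fun k => ?_⟩
    · simpa using (tendsto_pow_atTop_nhds_zero_of_lt_one (by norm_num : (0 : ℝ) ≤ 1 / 2)
        (by norm_num)).const_mul r
    · simp only [Set.mem_Ioi]; positivity
  have h := dist_le_of_le_geometric_of_tendsto₀ ((1 / 2 : ℝ) ^ β)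
    (2 ^ n * ((lipIntNorm β q f).toReal * r ^ β)) hlt (fun k => ?_) (hx _ hδ)
  · simpa [Real.dist_eq] using h
  · rw [dist_comm, Real.dist_eq]
    have hk : 0 < r * (1 / 2 : ℝ) ^ k := by positivity
    have hk' : 0 < r * (1 / 2 : ℝ) ^ (k + 1) := by positivity
    refine (abs_setAvg_sub_setAvg_le hn hq hf hN hk' hk (cube_subset_cube ?_)).trans_eq ?_
    · rw [dist_self, pow_succ]; linarith
    · have e1 : r * (1 / 2 : ℝ) ^ k / (r * (1 / 2 : ℝ) ^ (k + 1)) = 2 := by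
        rw [pow_succ]; field_simp
      have e2 : ((1 / 2 : ℝ) ^ β) ^ k = ((1 / 2 : ℝ) ^ k) ^ β := by
        rw [← Real.rpow_natCast, ← Real.rpow_natCast, ← Real.rpow_mul (by norm_num),
          ← Real.rpow_mul (by norm_num), mul_comm]
      rw [e1, e2, Real.mul_rpow hr.le (by positivity)]
      ring

/-- The constant in the Campanato-type estimate `ae_abs_sub_le`. -/
def campanatoConst (n : ℕ) (β : ℝ) : ℝ :=
  2 * (2 ^ n / (1 - (1 / 2 : ℝ) ^ β) + 3 ^ n * 3 ^ β)

lemma campanatoConst_pos (n : ℕ) {β : ℝ} (hβ : 0 < β) : 0 < campanatoConst n β := by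
  have hlt : (1 / 2 : ℝ) ^ β < 1 := Real.rpow_lt_one (by norm_num) (by norm_num) hβ
  have : 0 < 1 - (1 / 2 : ℝ) ^ β := by linarith
  unfold campanatoConst
  positivity

lemma ae_abs_sub_le {n : ℕ} (hn : 1 ≤ n) {β q : ℝ} (hβ : 0 < β) (hq : 1 ≤ q)
    {f : EuclideanSpace ℝ (Fin n) → ℝ} (hf : LocallyIntegrable f volume)
    (hN : lipIntNorm β q f ≠ ∞) :
    ∃ S : Set (EuclideanSpace ℝ (Fin n)), (∀ᵐ x, x ∈ S) ∧ ∀ x ∈ S, ∀ y ∈ S,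
      |f x - f y| ≤ campanatoConst n β * (lipIntNorm β q f).toReal * dist x y ^ β := by
  refine ⟨_, ae_tendsto_setAvg_cube hf, fun x hx y hy => ?_⟩
  rcases eq_or_ne x y with rfl | hxy
  · simp [Real.zero_rpow hβ.ne']
  have hr : 0 < dist x y := dist_pos.2 hxy
  have h3r : 0 < 3 * dist x y := by positivity
  set r := dist x y with hrdef
  have h1 := abs_setAvg_sub_limit_le hn hβ hq hf hN hx hr
  have h2 := abs_setAvg_sub_limit_le hn hβ hq hf hN hy hr
  have h3 := abs_setAvg_sub_setAvg_le hn hq hf hN hr h3r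
    (cube_subset_cube (x := x) (y := x) (by rw [dist_self]; linarith))
  have h4 := abs_setAvg_sub_setAvg_le hn hq hf hN hr h3r
    (cube_subset_cube (x := y) (y := x) (by rw [dist_comm, ← hrdef]; linarith))
  rw [mul_div_cancel_right₀ _ hr.ne', Real.mul_rpow (by norm_num) hr.le] at h3 h4
  have : campanatoConst n β * (lipIntNorm β q f).toReal * r ^ β =
      2 * (2 ^ n * ((lipIntNorm β q f).toReal * r ^ β) / (1 - (1 / 2 : ℝ) ^ β)) +
      2 * (3 ^ n * ((lipIntNorm β q f).toReal * (3 ^ β * r ^ β))) := by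
    unfold campanatoConst; ring
  rw [this]
  rw [abs_le] at *
  constructor <;> linarith [h1.1, h1.2, h2.1, h2.2, h3.1, h3.2, h4.1, h4.2]

/-- McShane extension for Hölder functions. -/
lemma exists_holder_extension {X : Type*} [PseudoMetricSpace X] {β : ℝ} (hβ0 : 0 < β)
    (hβ1 : β ≤ 1) {f : X → ℝ} {S : Set X} {K : ℝ} (hK : 0 ≤ K)
    (h : ∀ x ∈ S, ∀ y ∈ S, |f x - f y| ≤ K * dist x y ^ β) :
    ∃ g : X → ℝ, (∀ x y, |g x - g y| ≤ K * dist x y ^ β) ∧ Set.EqOn f g S := by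
  let e := (Metric.Snowflaking.toSnowflaking : X ≃ Metric.Snowflaking X β hβ0 hβ1)
  have hL : LipschitzOnWith ⟨K, hK⟩ (f ∘ e.symm) (e.symm ⁻¹' S) :=
    LipschitzOnWith.of_dist_le_mul fun x hx y hy => by
      have := h _ hx _ hy
      rw [Real.dist_eq]
      refine this.trans_eq ?_
      rw [← Metric.Snowflaking.dist_toSnowflaking_toSnowflaking (hα₀ := hβ0) (hα₁ := hβ1)]
      simp only [e, Equiv.apply_symm_apply]
      rfl
  obtain ⟨g, hg, hfg⟩ := hL.extend_real
  refine ⟨g ∘ e, fun x y => ?_, fun x hx => ?_⟩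
  · have := hg.dist_le_mul (e x) (e y)
    rw [Real.dist_eq] at this
    rwa [Metric.Snowflaking.dist_toSnowflaking_toSnowflaking] at this
  · have := hfg (x := e x) (by simpa using hx)
    simpa using this

lemma nonneg_of_mem_lipConstSet {n : ℕ} (hn : 1 ≤ n) {β : ℝ}
    {g : EuclideanSpace ℝ (Fin n) → ℝ} {K : ℝ} (hK : K ∈ LipConstSet β g) : 0 ≤ K := by
  have h := (abs_nonneg _).trans (hK (EuclideanSpace.single ⟨0, hn⟩ 1) 0)
  simpa using h

lemma lipNorm_le {n : ℕ} (hn : 1 ≤ n) {β : ℝ}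
    {g : EuclideanSpace ℝ (Fin n) → ℝ} {K : ℝ} (hK : K ∈ LipConstSet β g) : lipNorm β g ≤ K :=
  csInf_le ⟨0, fun _ h => nonneg_of_mem_lipConstSet hn h⟩ hK

lemma lipNorm_mem {n : ℕ} {β : ℝ} (hβ : 0 < β)
    {g : EuclideanSpace ℝ (Fin n) → ℝ} (hg : MemLip β g) : lipNorm β g ∈ LipConstSet β g := by
  intro x y
  rcases eq_or_ne x y with rfl | hxy
  · simp [Real.zero_rpow hβ.ne']
  have hr : 0 < dist x y ^ β := Real.rpow_pos_of_pos (dist_pos.2 hxy) _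
  rw [← div_le_iff₀ hr]
  exact le_csInf hg fun K hK => (div_le_iff₀ hr).2 (hK x y)

lemma continuous_of_mem_lipConstSet {n : ℕ} {β : ℝ} (hβ : 0 < β)
    {g : EuclideanSpace ℝ (Fin n) → ℝ} {K : ℝ} (hK : K ∈ LipConstSet β g) : Continuous g := by
  rw [continuous_iff_continuousAt]
  intro x
  rw [ContinuousAt, tendsto_iff_dist_tendsto_zero]
  have hlim : Filter.Tendsto (fun y => K * dist y x ^ β) (nhds x) (nhds 0) := by
    have hc : Continuous fun y => K * dist y x ^ β :=
      continuous_const.mul ((continuous_id.dist continuous_const).rpow_const fun _ => .inr hβ.le)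
    simpa [Real.zero_rpow hβ.ne'] using hc.tendsto x
  exact squeeze_zero (fun _ => dist_nonneg) (fun y => hK y x) hlim

lemma mem_lipConstSet_of_dense {n : ℕ} {β : ℝ} (hβ : 0 < β)
    {g : EuclideanSpace ℝ (Fin n) → ℝ} (hg : Continuous g) {S : Set (EuclideanSpace ℝ (Fin n))}
    (hS : Dense S) {K : ℝ} (h : ∀ x ∈ S, ∀ y ∈ S, |g x - g y| ≤ K * dist x y ^ β) :
    K ∈ LipConstSet β g := by
  have hclosed : IsClosed {p : EuclideanSpace ℝ (Fin n) × EuclideanSpace ℝ (Fin n) |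
      |g p.1 - g p.2| ≤ K * dist p.1 p.2 ^ β} :=
    isClosed_le (by fun_prop) (continuous_const.mul
      (continuous_dist.rpow_const fun _ => .inr hβ.le))
  intro x y
  exact hclosed.closure_subset_iff.2 (fun p hp => h _ hp.1 _ hp.2) ((hS.prod hS) (x, y))

lemma dist_le_of_mem_cube {n : ℕ} {x y z : EuclideanSpace ℝ (Fin n)} {r : ℝ} (hr : 0 ≤ r)
    (hy : y ∈ cube x r) (hz : z ∈ cube x r) : dist y z ≤ √n * r := by
  rw [EuclideanSpace.dist_eq]
  refine (Real.sqrt_le_sqrt (Finset.sum_le_sum (g := fun _ => r ^ 2) fun i _ => ?_)).trans_eq ?_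
  · have h1 := abs_le.1 (hy i)
    have h2 := abs_le.1 (hz i)
    refine pow_le_pow_left₀ dist_nonneg ?_ 2
    rw [Real.dist_eq, abs_le]
    constructor <;> linarith
  · simp [Real.sqrt_sq hr]

lemma lipIntNorm_le {n : ℕ} (hn : 1 ≤ n) {β q : ℝ} (hβ : 0 < β) (hq : 1 ≤ q)
    {f g : EuclideanSpace ℝ (Fin n) → ℝ} (hf : LocallyIntegrable f volume) (hfg : f =ᵐ[volume] g)
    {K : ℝ} (hK : K ∈ LipConstSet β g) :
    lipIntNorm β q f ≤ ENNReal.ofReal (√n ^ β * K) := by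
  have hK0 := nonneg_of_mem_lipConstSet hn hK
  refine iSup_le fun x => iSup_le fun r => iSup_le fun hr => ?_
  have hV : volume (cube x r) = ENNReal.ofReal (r ^ n) := volume_cube x hr.le
  have hV0 : volume (cube x r) ≠ 0 := by rw [hV]; simp; positivity
  have hVt : volume (cube x r) ≠ ∞ := by rw [hV]; simp
  have hmeas : MeasurableSet (cube x r) := (isCompact_cube x hr.le).measurableSet
  have hint := hf.integrableOn_isCompact (isCompact_cube x hr.le)
  set M : ℝ := K * (√n * r) ^ β with hM
  have hM0 : 0 ≤ M := by positivity
  have hae : ∀ᵐ y ∂volume.restrict (cube x r), |f y - setAvg (cube x r) f| ≤ M := by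
    filter_upwards [ae_restrict_mem hmeas, ae_restrict_of_ae hfg] with y hy hyfg
    rw [abs_sub_comm]
    refine (abs_setAvg_sub_le hf x hr (f y)).trans ?_
    rw [inv_mul_le_iff₀ (by positivity)]
    have : ∫ z in cube x r, |f z - f y| ≤ ∫ z in cube x r, M := by
      refine integral_mono_ae ((hint.sub (integrableOn_const hVt)).abs) (integrableOn_const hVt) ?_
      filter_upwards [ae_restrict_mem hmeas, ae_restrict_of_ae hfg] with z hz hzfg
      rw [hzfg, hyfg]
      refine (hK z y).trans ?_
      rw [hM]
      gcongr
      exact dist_le_of_mem_cube hr.le hz hy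
    rwa [setIntegral_const, measureReal_def, hV, ENNReal.toReal_ofReal (by positivity),
      smul_eq_mul] at this
  calc volume (cube x r) ^ (-(β / n)) * ((volume (cube x r))⁻¹ *
        ∫⁻ y in cube x r, ENNReal.ofReal |f y - setAvg (cube x r) f| ^ q) ^ (1 / q)
      ≤ volume (cube x r) ^ (-(β / n)) * ((volume (cube x r))⁻¹ *
        ∫⁻ y in cube x r, ENNReal.ofReal M ^ q) ^ (1 / q) := by
        gcongr ?_ * (_ * ?_) ^ _
        · exact le_rfl
        · refine lintegral_mono_ae (hae.mono fun y hy => ?_)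
          gcongr
    _ = ENNReal.ofReal (r ^ (-β)) * ENNReal.ofReal M := by
        rw [setLIntegral_const, mul_comm (_ ^ q), ← mul_assoc, ENNReal.inv_mul_cancel hV0 hVt,
          one_mul, one_div, ENNReal.rpow_rpow_inv (by positivity),
          volume_cube_rpow hn β x hr]
    _ = ENNReal.ofReal (√n ^ β * K) := by
        rw [← ENNReal.ofReal_mul (by positivity), hM, Real.mul_rpow (by positivity) hr.le,
          Real.rpow_neg hr.le]
        congr 1
        have : r ^ β ≠ 0 := (Real.rpow_pos_of_pos hr β).ne'
        field_simp

theorem statement4 (n : ℕ) (hn : 1 ≤ n) (β q : ℝ) (hβ0 : 0 < β) (hβ1 : β < 1)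
    (hq : 1 ≤ q) :
    ∃ c > (0 : ℝ), ∃ C > (0 : ℝ), ∀ f : EuclideanSpace ℝ (Fin n) → ℝ, LocallyIntegrable f volume →
      ((lipIntNorm β q f ≠ ∞) ↔ ∃ g : EuclideanSpace ℝ (Fin n) → ℝ, MemLip β g ∧ f =ᵐ[volume] g) ∧
      (∀ g : EuclideanSpace ℝ (Fin n) → ℝ, MemLip β g → f =ᵐ[volume] g →
        ENNReal.ofReal (c * lipNorm β g) ≤ lipIntNorm β q f ∧
        lipIntNorm β q f ≤ ENNReal.ofReal (C * lipNorm β g)) := by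

  have hc := campanatoConst_pos n hβ0
  have hn0 : (0 : ℝ) < n := by exact_mod_cast hn
  refine ⟨(campanatoConst n β)⁻¹, by positivity, √n ^ β, by positivity, fun f hf => ⟨⟨?_, ?_⟩, ?_⟩⟩
  · intro hN
    obtain ⟨S, hS, h⟩ := ae_abs_sub_le hn hβ0 hq hf hN
    obtain ⟨g, hg, hfg⟩ := exists_holder_extension hβ0 hβ1.le (by positivity) h
    exact ⟨g, ⟨_, hg⟩, hS.mono fun x hx => hfg hx⟩
  · rintro ⟨g, hg, hfg⟩
    exact ne_top_of_le_ne_top ENNReal.ofReal_ne_top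
      (lipIntNorm_le hn hβ0 hq hf hfg (lipNorm_mem hβ0 hg))
  · intro g hg hfg
    have hup := lipIntNorm_le hn hβ0 hq hf hfg (lipNorm_mem hβ0 hg)
    refine ⟨?_, hup⟩
    have hN := ne_top_of_le_ne_top ENNReal.ofReal_ne_top hup
    obtain ⟨S, hS, h⟩ := ae_abs_sub_le hn hβ0 hq hf hN
    have hdense := Measure.dense_of_ae (hS.and hfg)
    have hle := lipNorm_le hn (mem_lipConstSet_of_dense hβ0
      (continuous_of_mem_lipConstSet hβ0 (lipNorm_mem hβ0 hg)) hdense fun x hx y hy => by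
        rw [← hx.2, ← hy.2]; exact h x hx.1 y hy.1)
    refine ENNReal.ofReal_le_of_le_toReal ?_
    rwa [inv_mul_le_iff₀ hc]

end
end

section
/- Let n ≥ 1, 0 < α < n, 1 < p < n/α and 1/q = 1/p − α/n. Let Ω be homogeneous of degree zero, have mean value zero on S^{n−1}, and be a Lipschitz function. Then there exists a constant C such that for every f ∈ L^p(ℝ^n), ‖T_{Ω,α} f‖_{L^q(ℝ^n)} ≤ C ‖f‖_{L^p(ℝ^n)}. -/
open MeasureTheory ENNReal Metric

noncomputable section

theorem lintegral_Ioo_rpow_sub_one {s R : ℝ} (hs : 0 < s) (hR : 0 ≤ R) :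
    ∫⁻ t in Set.Ioo 0 R, ENNReal.ofReal (t ^ (s - 1)) = ENNReal.ofReal (R ^ s / s) := by
  have hint : IntervalIntegrable (fun t : ℝ => t ^ (s - 1)) volume 0 R :=
    intervalIntegral.intervalIntegrable_rpow' (by linarith)
  rw [setLIntegral_congr Ioo_ae_eq_Ioc, ← ofReal_integral_eq_lintegral_ofReal,
    ← intervalIntegral.integral_of_le hR, integral_rpow (Or.inl (by linarith)), sub_add_cancel,
    Real.zero_rpow hs.ne', sub_zero]
  · exact (intervalIntegrable_iff_integrableOn_Ioc_of_le hR).1 hint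
  · filter_upwards [ae_restrict_mem measurableSet_Ioc] with t ht
    exact Real.rpow_nonneg ht.1.le _

theorem lintegral_Ioi_rpow_neg_sub_one {s R : ℝ} (hs : 0 < s) (hR : 0 < R) :
    ∫⁻ t in Set.Ioi R, ENNReal.ofReal (t ^ (-s - 1)) = ENNReal.ofReal (R ^ (-s) / s) := by
  rw [← ofReal_integral_eq_lintegral_ofReal, integral_Ioi_rpow_of_lt (by linarith) hR,
    sub_add_cancel, neg_div_neg_eq]
  · exact integrableOn_Ioi_rpow_of_lt (by linarith) hR
  · filter_upwards [ae_restrict_mem measurableSet_Ioi] with t ht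
    exact Real.rpow_nonneg (hR.trans ht).le _

theorem setLIntegral_Ioi_indicator_rpow {s : ℝ} (hs : 0 < s) (a : ℝ≥0∞) :
    ∫⁻ t in Set.Ioi (0 : ℝ), {t : ℝ | ENNReal.ofReal t < a}.indicator
      (fun t => ENNReal.ofReal (s * t ^ (s - 1))) t = a ^ s := by
  have hmeas (a : ℝ≥0∞) : MeasurableSet {t : ℝ | ENNReal.ofReal t < a} :=
    measurableSet_lt ENNReal.measurable_ofReal measurable_const
  have hfin (a : ℝ≥0∞) (ha : a ≠ ∞) : ∫⁻ t in Set.Ioi (0 : ℝ),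
      {t : ℝ | ENNReal.ofReal t < a}.indicator
        (fun t => ENNReal.ofReal (s * t ^ (s - 1))) t = a ^ s := by
    have hset : {t : ℝ | ENNReal.ofReal t < a} ∩ Set.Ioi 0 = Set.Ioo 0 a.toReal := by
      ext t
      simp only [Set.mem_inter_iff, Set.mem_ofPred_eq, Set.mem_Ioi, Set.mem_Ioo]
      constructor
      · exact fun h => ⟨h.2, (ENNReal.ofReal_lt_iff_lt_toReal h.2.le ha).1 h.1⟩
      · exact fun h => ⟨(ENNReal.ofReal_lt_iff_lt_toReal h.1.le ha).2 h.2, h.1⟩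
    rw [lintegral_indicator (hmeas a), Measure.restrict_restrict (hmeas a), hset]
    simp_rw [ENNReal.ofReal_mul hs.le]
    rw [lintegral_const_mul' _ _ ENNReal.ofReal_ne_top,
      lintegral_Ioo_rpow_sub_one hs ENNReal.toReal_nonneg, ← ENNReal.ofReal_mul hs.le,
      mul_div_cancel₀ _ hs.ne', ENNReal.toReal_rpow,
      ENNReal.ofReal_toReal (ENNReal.rpow_ne_top_of_nonneg hs.le ha)]
  by_cases ha : a = ∞
  · subst ha
    rw [ENNReal.top_rpow_of_pos hs]
    refine ENNReal.eq_top_of_forall_nnreal_le fun r => ?_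
    have h : ((r : ℝ≥0∞) ^ (1 / s)) ^ s = r := by
      rw [← ENNReal.rpow_mul, one_div_mul_cancel hs.ne', ENNReal.rpow_one]
    rw [← h, ← hfin _ (ENNReal.rpow_ne_top_of_nonneg (by positivity) ENNReal.coe_ne_top)]
    refine lintegral_mono fun t => ?_
    exact Set.indicator_le_indicator_of_subset (fun t _ => ENNReal.ofReal_lt_top)
      (fun _ => zero_le) t
  · exact hfin a ha

/-- Optimal splitting of an integral whose integrand is controlled by one power near zero and by
another one near infinity. -/
theorem lintegral_Ioi_le_of_le_rpow {a b : ℝ} (ha : 0 < a) (hb : 0 < b) {A B : ℝ≥0∞}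
    {h : ℝ → ℝ≥0∞} (hA : ∀ r > 0, h r ≤ A * ENNReal.ofReal (r ^ (a - 1)))
    (hB : ∀ r > 0, h r ≤ B * ENNReal.ofReal (r ^ (-b - 1))) :
    ∫⁻ r in Set.Ioi 0, h r ≤
      ENNReal.ofReal (1 / a + 1 / b) * (A ^ (b / (a + b)) * B ^ (a / (a + b))) := by
  have hzero (H : ∀ r > 0, h r = 0) : ∫⁻ r in Set.Ioi 0, h r = 0 := by
    rw [setLIntegral_congr_fun (g := fun _ => 0) measurableSet_Ioi fun r hr => H r hr]
    simp
  have hc : 0 < 1 / a + 1 / b := by positivity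
  have ht : 0 < b / (a + b) := by positivity
  have ht' : 0 < a / (a + b) := by positivity
  rcases eq_or_ne A 0 with rfl | hA0
  · rw [hzero fun r hr => by simpa using hA r hr]; exact zero_le
  rcases eq_or_ne B 0 with rfl | hB0
  · rw [hzero fun r hr => by simpa using hB r hr]; exact zero_le
  rcases eq_or_ne A ∞ with rfl | hAt
  · rw [ENNReal.top_rpow_of_pos ht, ENNReal.top_mul, ENNReal.mul_top]
    · exact le_top
    · simpa using hc
    · simp [ENNReal.rpow_eq_zero_iff, hB0, ht'.le.not_gt]
  rcases eq_or_ne B ∞ with rfl | hBt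
  · rw [ENNReal.top_rpow_of_pos ht', ENNReal.mul_top, ENNReal.mul_top]
    · exact le_top
    · simpa using hc
    · simp [ENNReal.rpow_eq_zero_iff, hA0, ht.le.not_gt]
  lift A to NNReal using hAt
  lift B to NNReal using hBt
  have hA' : (0 : ℝ) < A := by simpa [pos_iff_ne_zero] using hA0
  have hB' : (0 : ℝ) < B := by simpa [pos_iff_ne_zero] using hB0
  set R : ℝ := ((B : ℝ) / A) ^ (1 / (a + b)) with hRdef
  have hR : 0 < R := by positivity
  have hsplit : ∫⁻ r in Set.Ioi 0, h r ≤ (∫⁻ r in Set.Ioo 0 R, h r) + ∫⁻ r in Set.Ioi R, h r := by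
    rw [setLIntegral_congr Ioo_ae_eq_Ioc, ← Set.Ioc_union_Ioi_eq_Ioi hR.le]
    exact lintegral_union_le _ _ _
  have h1 : ∫⁻ r in Set.Ioo 0 R, h r ≤ A * ENNReal.ofReal (R ^ a / a) := by
    rw [← lintegral_Ioo_rpow_sub_one ha hR.le, ← lintegral_const_mul' _ _ ENNReal.coe_ne_top]
    exact setLIntegral_mono' measurableSet_Ioo fun r hr => hA r hr.1
  have h2 : ∫⁻ r in Set.Ioi R, h r ≤ B * ENNReal.ofReal (R ^ (-b) / b) := by
    rw [← lintegral_Ioi_rpow_neg_sub_one hb hR, ← lintegral_const_mul' _ _ ENNReal.coe_ne_top]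
    exact setLIntegral_mono' measurableSet_Ioi fun r hr => hB r (hR.trans hr)
  have e1 : (A : ℝ) * R ^ a = A ^ (b / (a + b)) * B ^ (a / (a + b)) := by
    rw [hRdef, ← Real.rpow_mul (by positivity), Real.div_rpow hB'.le hA'.le,
      show b / (a + b) = 1 - 1 / (a + b) * a by field_simp; ring, Real.rpow_sub hA', Real.rpow_one,
      show a / (a + b) = 1 / (a + b) * a by field_simp]
    field_simp
  have e2 : (B : ℝ) * R ^ (-b) = A ^ (b / (a + b)) * B ^ (a / (a + b)) := by
    rw [hRdef, ← Real.rpow_mul (by positivity), mul_neg, Real.rpow_neg (by positivity),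
      Real.div_rpow hB'.le hA'.le,
      show a / (a + b) = 1 - 1 / (a + b) * b by field_simp; ring, Real.rpow_sub hB', Real.rpow_one,
      show b / (a + b) = 1 / (a + b) * b by field_simp]
    field_simp
  refine (hsplit.trans (add_le_add h1 h2)).trans (le_of_eq ?_)
  rw [← ENNReal.ofReal_coe_nnreal, ← ENNReal.ofReal_coe_nnreal, ENNReal.ofReal_rpow_of_pos hA',
    ENNReal.ofReal_rpow_of_pos hB', ← ENNReal.ofReal_mul hA'.le, ← ENNReal.ofReal_mul hB'.le,
    ← ENNReal.ofReal_mul (by positivity), ← ENNReal.ofReal_mul (by positivity),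
    ← ENNReal.ofReal_add (by positivity) (by positivity), ← mul_div_assoc, ← mul_div_assoc, e1, e2]
  congr 1
  ring

theorem lintegral_mul_lintegral_indicator_swap {X Y : Type*} [MeasurableSpace X]
    [MeasurableSpace Y] {μ : Measure X} {ν : Measure Y} [SFinite μ] [SFinite ν] {S : Set (X × Y)}
    (hS : MeasurableSet S) {k : X → ℝ≥0∞} (hk : Measurable k) {w : Y → ℝ≥0∞}
    (hw : Measurable w) :
    ∫⁻ x, k x * (∫⁻ t, {t | (x, t) ∈ S}.indicator w t ∂ν) ∂μ =
      ∫⁻ t, w t * ∫⁻ x in {x | (x, t) ∈ S}, k x ∂μ ∂ν := by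
  have hm : Measurable fun z : X × Y => k z.1 * S.indicator (fun z => w z.2) z :=
    (hk.comp measurable_fst).mul ((hw.comp measurable_snd).indicator hS)
  have h1 (x : X) : k x * (∫⁻ t, {t | (x, t) ∈ S}.indicator w t ∂ν) =
      ∫⁻ t, k x * {t | (x, t) ∈ S}.indicator w t ∂ν :=
    (lintegral_const_mul _ (hw.indicator (measurable_prodMk_left hS))).symm
  simp_rw [h1]
  rw [lintegral_lintegral_swap hm.aemeasurable]
  refine lintegral_congr fun t => ?_
  have ht : MeasurableSet {x | (x, t) ∈ S} := measurable_prodMk_right hS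
  rw [← lintegral_indicator ht, ← lintegral_const_mul _ (hk.indicator ht)]
  refine lintegral_congr fun x => ?_
  by_cases hx : (x, t) ∈ S <;> simp [hx, mul_comm]

section MaximalFunction

variable {E : Type*} [NormedAddCommGroup E] [NormedSpace ℝ E] [FiniteDimensional ℝ E]
  [MeasurableSpace E] [BorelSpace E] (μ : Measure E) [μ.IsAddHaarMeasure]

/-- The centered Hardy–Littlewood maximal function over balls of rational radius. -/
def ratMaximal (f : E → ℝ≥0∞) (x : E) : ℝ≥0∞ :=
  ⨆ r : {r : ℚ // 0 < r}, ⨍⁻ y in closedBall x (r : ℚ), f y ∂μ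

variable {μ}

theorem measurable_setLIntegral_closedBall {f : E → ℝ≥0∞} (hf : Measurable f) (r : ℝ) :
    Measurable fun x => ∫⁻ y in closedBall x r, f y ∂μ := by
  have h : Measurable fun z : E × E => {z : E × E | dist z.2 z.1 ≤ r}.indicator
      (fun z => f z.2) z :=
    (hf.comp measurable_snd).indicator
      (isClosed_le (by fun_prop) continuous_const).measurableSet
  simp_rw [← lintegral_indicator isClosed_closedBall.measurableSet]
  exact h.lintegral_prod_right'

theorem measurable_ratMaximal {f : E → ℝ≥0∞} (hf : Measurable f) :
    Measurable (ratMaximal μ f) := by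
  refine Measurable.iSup fun r => ?_
  simp_rw [setLAverage_eq, Measure.addHaar_closedBall_center μ]
  exact (measurable_setLIntegral_closedBall hf _).div_const _

omit [BorelSpace E] in
theorem ratMaximal_le_add {f g : E → ℝ≥0∞} {s : ℝ≥0∞} (h : ∀ x, f x ≤ g x + s) (x : E) :
    ratMaximal μ f x ≤ ratMaximal μ g x + s := by
  refine iSup_le fun r => ?_
  have hr : (0 : ℝ) < (r : ℚ) := by exact_mod_cast r.2
  have h0 : μ (closedBall x (r : ℚ)) ≠ 0 := (measure_closedBall_pos μ x hr).ne'
  calc ⨍⁻ y in closedBall x (r : ℚ), f y ∂μ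
      ≤ ⨍⁻ y in closedBall x (r : ℚ), g y + s ∂μ := lintegral_mono h
    _ = (⨍⁻ y in closedBall x (r : ℚ), g y ∂μ) + s := by
      rw [setLAverage_eq, setLAverage_eq, lintegral_add_right _ measurable_const,
        setLIntegral_const, ENNReal.add_div, ENNReal.mul_div_cancel_right h0
          measure_closedBall_lt_top.ne]
    _ ≤ _ := by
      gcongr
      exact le_iSup (fun r : {r : ℚ // 0 < r} => ⨍⁻ y in closedBall x (r : ℚ), g y ∂μ) r

/-- The weak type `(1, 1)` inequality. -/
theorem measure_lt_ratMaximal_le [Nontrivial E] (f : E → ℝ≥0∞) {t : ℝ≥0∞} (ht0 : t ≠ 0)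
    (ht : t ≠ ∞) :
    μ {x | t < ratMaximal μ f x} ≤ 5 ^ Module.finrank ℝ E / t * ∫⁻ x, f x ∂μ := by
  set d := Module.finrank ℝ E 
  have hdpos : 1 ≤ d := Module.finrank_pos
  rcases eq_or_ne (∫⁻ x, f x ∂μ) ∞ with hI | hI
  · rw [hI, ENNReal.mul_top]
    · exact le_top
    · exact (ENNReal.div_pos (by positivity) ht).ne'
  let S : Set (E × ℚ) :=
    {a | 0 < a.2 ∧ t * μ (closedBall a.1 a.2) < ∫⁻ y in closedBall a.1 a.2, f y ∂μ}
  have hball (x : E) {r : ℝ} (hr : 0 ≤ r) :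
      μ (closedBall x r) = ENNReal.ofReal (r ^ d) * μ (ball 0 1) :=
    Measure.addHaar_closedBall μ x hr
  set V := μ (ball (0 : E) 1)
  have hV0 : V ≠ 0 := (measure_ball_pos μ _ one_pos).ne'
  have hVt : V ≠ ∞ := measure_ball_lt_top.ne
  have hbdd : ∀ a ∈ S, ((a.2 : ℚ) : ℝ) ≤ max 1 ((∫⁻ x, f x ∂μ) / (t * V)).toReal := by
    rintro ⟨x, r⟩ ⟨hr, hlt⟩
    have hr' : (0 : ℝ) < r := by exact_mod_cast hr
    rcases le_total (r : ℝ) 1 with h1 | h1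
    · exact h1.trans (le_max_left _ _)
    refine le_trans ?_ (le_max_right _ _)
    refine (le_self_pow₀ h1 (by omega : d ≠ 0)).trans ?_
    have hne : (∫⁻ x, f x ∂μ) / (t * V) ≠ ∞ :=
      ENNReal.div_ne_top hI (mul_ne_zero ht0 hV0)
    rw [← ENNReal.ofReal_le_iff_le_toReal hne,
      ENNReal.le_div_iff_mul_le (Or.inl (mul_ne_zero ht0 hV0))
        (Or.inl (ENNReal.mul_ne_top ht hVt))]
    simp only [hball x hr'.le] at hlt
    calc ENNReal.ofReal ((r : ℝ) ^ d) * (t * V)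
        = t * (ENNReal.ofReal ((r : ℝ) ^ d) * V) := by ring
      _ ≤ _ := hlt.le.trans (setLIntegral_le_lintegral _ _)
  obtain ⟨u, huS, hudisj, hucov⟩ := Vitali.exists_disjoint_subfamily_covering_enlargement_closedBall
    S (fun a => a.1) (fun a => ((a.2 : ℚ) : ℝ)) _ hbdd 5 (by norm_num)
  have hpos : ∀ a ∈ u, (0 : ℝ) < (a.2 : ℚ) := fun a ha => by exact_mod_cast (huS ha).1
  have hucount : u.Countable := hudisj.countable_of_nonempty_interior fun a ha =>
    ⟨a.1, ball_subset_interior_closedBall (mem_ball_self (hpos a ha))⟩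
  have hsub : {x | t < ratMaximal μ f x} ⊆ ⋃ a ∈ u, closedBall a.1 (5 * (a.2 : ℚ)) := by
    intro x hx
    obtain ⟨r, hr⟩ := lt_iSup_iff.1 (show t < ratMaximal μ f x from hx)
    have hr0 : (0 : ℝ) < (r : ℚ) := by exact_mod_cast r.2
    rw [setLAverage_eq, ENNReal.lt_div_iff_mul_lt
      (Or.inl (measure_closedBall_pos μ x hr0).ne') (Or.inl measure_closedBall_lt_top.ne)] at hr
    obtain ⟨b, hb, hsubb⟩ := hucov (x, (r : ℚ)) ⟨r.2, hr⟩
    exact Set.mem_biUnion hb (hsubb (mem_closedBall_self hr0.le))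
  have hterm (a : u) : μ (closedBall a.1.1 (5 * (a.1.2 : ℚ))) ≤
      5 ^ d / t * ∫⁻ y in closedBall a.1.1 a.1.2, f y ∂μ := by
    have ha := hpos a a.2
    have hlt := (huS a.2).2.le
    have h5 : μ (closedBall a.1.1 (5 * (a.1.2 : ℚ))) = 5 ^ d * μ (closedBall a.1.1 a.1.2) := by
      rw [hball _ ha.le, hball _ (by positivity), mul_pow, ENNReal.ofReal_mul (by positivity),
        mul_assoc, ENNReal.ofReal_pow (by norm_num)]
      norm_num
    rw [h5, div_eq_mul_inv, mul_assoc]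
    gcongr
    rw [← ENNReal.mul_le_iff_le_inv ht0 ht]
    exact hlt
  calc μ {x | t < ratMaximal μ f x}
      ≤ μ (⋃ a ∈ u, closedBall a.1 (5 * (a.2 : ℚ))) := measure_mono hsub
    _ ≤ ∑' a : u, μ (closedBall a.1.1 (5 * (a.1.2 : ℚ))) := measure_biUnion_le _ hucount _
    _ ≤ ∑' a : u, 5 ^ d / t * ∫⁻ y in closedBall a.1.1 a.1.2, f y ∂μ :=
      ENNReal.tsum_le_tsum hterm
    _ = 5 ^ d / t * ∫⁻ y in ⋃ a ∈ u, closedBall a.1 a.2, f y ∂μ := by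
      rw [ENNReal.tsum_mul_left, lintegral_biUnion hucount
        (fun a _ => isClosed_closedBall.measurableSet) hudisj]
    _ ≤ _ := mul_le_mul_right (setLIntegral_le_lintegral _ _) _

/-- The Hardy–Littlewood maximal inequality. -/
theorem lintegral_ratMaximal_rpow_le [Nontrivial E] {p : ℝ} (hp : 1 < p) {f : E → ℝ≥0∞}
    (hf : Measurable f) :
    ∫⁻ x, ratMaximal μ f x ^ p ∂μ ≤
      5 ^ Module.finrank ℝ E * ENNReal.ofReal (2 * p / (p - 1)) * 2 ^ (p - 1) *
        ∫⁻ x, f x ^ p ∂μ := by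
  set d := Module.finrank ℝ E
  have hp0 : 0 < p := by linarith
  have hp1 : 0 < p - 1 := by linarith
  have hlevel {g : E → ℝ≥0∞} (hg : Measurable g) :
      MeasurableSet {z : E × ℝ | ENNReal.ofReal z.2 < g z.1} :=
    measurableSet_lt (by fun_prop) (by fun_prop)
  have hweak : ∀ t ∈ Set.Ioi (0 : ℝ), ENNReal.ofReal (p * t ^ (p - 1)) *
      μ {x | ENNReal.ofReal t < ratMaximal μ f x} ≤
      5 ^ d * ENNReal.ofReal (2 * p / (p - 1)) * (ENNReal.ofReal ((p - 1) * t ^ (p - 1 - 1)) *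
        ∫⁻ x in {x | ENNReal.ofReal t < 2 * f x}, f x ∂μ) := by
    intro t ht
    have ht : 0 < t := ht
    set s := ENNReal.ofReal (t / 2) with hs
    have hs0 : s ≠ 0 := by simp [hs, ht]
    have hst : s ≠ ∞ := ENNReal.ofReal_ne_top
    have hss : ENNReal.ofReal t = s + s := by
      rw [hs, ← ENNReal.ofReal_add (by positivity) (by positivity), add_halves]
    have hS : MeasurableSet {x | ENNReal.ofReal t < 2 * f x} :=
      measurableSet_lt measurable_const (by fun_prop)
    set g := {x | ENNReal.ofReal t < 2 * f x}.indicator f with hg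
    have hfg : ∀ x, f x ≤ g x + s := by
      intro x
      by_cases hx : ENNReal.ofReal t < 2 * f x
      · simp [hg, hx]
      · have : f x ≤ s := by
          rw [hss, ← two_mul, not_lt] at hx
          exact (ENNReal.mul_le_mul_iff_right (by norm_num) (by norm_num)).1 hx
        exact this.trans le_add_self
    have hsub : {x | ENNReal.ofReal t < ratMaximal μ f x} ⊆ {x | s < ratMaximal μ g x} := by
      intro x hx
      have h := lt_of_lt_of_le hx (ratMaximal_le_add (μ := μ) hfg x)
      rw [hss] at h
      exact lt_of_add_lt_add_right h
    have hcoef : ENNReal.ofReal (p * t ^ (p - 1)) * (5 ^ d / s) =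
        5 ^ d * ENNReal.ofReal (2 * p / (p - 1)) * ENNReal.ofReal ((p - 1) * t ^ (p - 1 - 1)) := by
      rw [mul_assoc, ← ENNReal.ofReal_mul (by positivity), mul_div_assoc', mul_comm,
        mul_div_assoc, hs, ← ENNReal.ofReal_div_of_pos (by positivity)]
      congr 2
      rw [Real.rpow_sub_one ht.ne' (p - 1)]
      field_simp
    calc _ ≤ ENNReal.ofReal (p * t ^ (p - 1)) * (5 ^ d / s * ∫⁻ x, g x ∂μ) := by
          gcongr
          exact (measure_mono hsub).trans (measure_lt_ratMaximal_le g hs0 hst)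
      _ = _ := by
          rw [← mul_assoc, hcoef, mul_assoc, hg, lintegral_indicator hS]
  have hw (s : ℝ) : Measurable fun t : ℝ => ENNReal.ofReal (s * t ^ (s - 1)) := by fun_prop
  calc ∫⁻ x, ratMaximal μ f x ^ p ∂μ
      = ∫⁻ t in Set.Ioi (0 : ℝ), ENNReal.ofReal (p * t ^ (p - 1)) *
          μ {x | ENNReal.ofReal t < ratMaximal μ f x} := by
        have h := lintegral_mul_lintegral_indicator_swap (μ := μ)
          (ν := volume.restrict (Set.Ioi (0 : ℝ))) (hlevel (measurable_ratMaximal (μ := μ) hf))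
          (k := fun _ => 1) measurable_const (hw p)
        simpa [setLIntegral_Ioi_indicator_rpow hp0] using h
    _ ≤ ∫⁻ t in Set.Ioi (0 : ℝ), 5 ^ d * ENNReal.ofReal (2 * p / (p - 1)) *
          (ENNReal.ofReal ((p - 1) * t ^ (p - 1 - 1)) *
            ∫⁻ x in {x | ENNReal.ofReal t < 2 * f x}, f x ∂μ) :=
        setLIntegral_mono' measurableSet_Ioi hweak
    _ = 5 ^ d * ENNReal.ofReal (2 * p / (p - 1)) * ∫⁻ x, f x * (2 * f x) ^ (p - 1) ∂μ := by
        have h := lintegral_mul_lintegral_indicator_swap (μ := μ)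
          (ν := volume.restrict (Set.Ioi (0 : ℝ))) (hlevel (hf.const_mul 2)) hf (hw (p - 1))
        simp only [Set.mem_ofPred_eq, setLIntegral_Ioi_indicator_rpow hp1] at h
        rw [lintegral_const_mul' _ _ (by finiteness), ← h]
    _ = _ := by
        rw [mul_assoc _ (2 ^ (p - 1))]
        congr 1
        rw [← lintegral_const_mul' _ _ (by finiteness)]
        refine lintegral_congr fun x => ?_
        have h : f x ^ p = f x * f x ^ (p - 1) := by
          conv_lhs => rw [show p = 1 + (p - 1) by ring,
            ENNReal.rpow_add_of_nonneg _ _ zero_le_one hp1.le, ENNReal.rpow_one]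
        rw [ENNReal.mul_rpow_of_nonneg _ _ hp1.le, h]
        ring

omit [BorelSpace E] in
theorem setLIntegral_closedBall_le_mul_ratMaximal (f : E → ℝ≥0∞) (x : E) {r : ℝ} (hr : 0 < r) :
    ∫⁻ y in closedBall x r, f y ∂μ ≤ μ (closedBall x (2 * r)) * ratMaximal μ f x := by
  obtain ⟨s, hrs, hs⟩ := exists_rat_btwn (show r < 2 * r by linarith)
  have hs0 : (0 : ℝ) < s := hr.trans hrs
  have h : (∫⁻ y in closedBall x s, f y ∂μ) / μ (closedBall x s) ≤ ratMaximal μ f x := by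
    rw [← setLAverage_eq]
    exact le_iSup (fun r : {r : ℚ // 0 < r} => ⨍⁻ y in closedBall x (r : ℚ), f y ∂μ)
      ⟨s, by exact_mod_cast hs0⟩
  rw [ENNReal.div_le_iff (measure_closedBall_pos μ x hs0).ne' measure_closedBall_lt_top.ne] at h
  calc ∫⁻ y in closedBall x r, f y ∂μ
      ≤ ∫⁻ y in closedBall x s, f y ∂μ := lintegral_mono_set (closedBall_subset_closedBall hrs.le)
    _ ≤ μ (closedBall x s) * ratMaximal μ f x := by rwa [mul_comm]
    _ ≤ _ := by gcongr

theorem setLIntegral_le_measure_rpow_mul {X : Type*} [MeasurableSpace X] {μ : Measure X} {p : ℝ}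
    (hp : 1 < p) {f : X → ℝ≥0∞} (hf : Measurable f) (s : Set X) :
    ∫⁻ y in s, f y ∂μ ≤ μ s ^ (1 - 1 / p) * (∫⁻ y, f y ^ p ∂μ) ^ (1 / p) := by
  have hpq := Real.HolderConjugate.conjExponent hp
  have h := ENNReal.lintegral_mul_le_Lp_mul_Lq (μ.restrict s) hpq.symm
    (f := fun _ => 1) aemeasurable_const hf.aemeasurable
  have hp' : 1 / p.conjExponent = 1 - 1 / p := by
    have := hpq.inv_add_inv_eq_one
    rw [one_div, one_div]
    linarith
  simp only [Pi.mul_apply, one_mul, ENNReal.one_rpow, lintegral_const, Measure.restrict_apply,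
    MeasurableSet.univ, Set.univ_inter, hp'] at h
  have hle := setLIntegral_le_lintegral (μ := μ) s fun y => f y ^ p
  exact h.trans (by gcongr)

variable (μ) in
/-- The (unnormalized) Riesz potential of order `α` of a nonnegative function. -/
def rieszPotential (α : ℝ) (f : E → ℝ≥0∞) (x : E) : ℝ≥0∞ :=
  ∫⁻ y, ENNReal.ofReal (‖x - y‖ ^ (α - Module.finrank ℝ E)) * f y ∂μ

theorem ofReal_rpow_neg_le_lintegral {s u : ℝ} (hs : 0 < s) (hu : 0 ≤ u) :
    ENNReal.ofReal (u ^ (-s)) ≤ ∫⁻ r in Set.Ioi (0 : ℝ),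
      {r : ℝ | u ≤ r}.indicator (fun r => ENNReal.ofReal (s * r ^ (-s - 1))) r := by
  rcases hu.eq_or_lt with rfl | hu
  · simp [Real.zero_rpow (neg_ne_zero.2 hs.ne')]
  have hset : {r : ℝ | u ≤ r} ∩ Set.Ioi 0 = Set.Ici u :=
    Set.inter_eq_left.2 fun r hr => hu.trans_le hr
  have hmeas : MeasurableSet {r : ℝ | u ≤ r} := measurableSet_Ici
  rw [lintegral_indicator hmeas, Measure.restrict_restrict hmeas, hset,
    setLIntegral_congr Ioi_ae_eq_Ici.symm]
  simp_rw [ENNReal.ofReal_mul hs.le]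
  rw [lintegral_const_mul' _ _ ENNReal.ofReal_ne_top, lintegral_Ioi_rpow_neg_sub_one hs hu,
    ← ENNReal.ofReal_mul hs.le, mul_div_cancel₀ _ hs.ne']

theorem rieszPotential_le_lintegral_closedBall {α : ℝ} (hα : α < Module.finrank ℝ E)
    {f : E → ℝ≥0∞} (hf : Measurable f) (x : E) :
    rieszPotential μ α f x ≤ ∫⁻ r in Set.Ioi (0 : ℝ),
      ENNReal.ofReal ((Module.finrank ℝ E - α) * r ^ (-(Module.finrank ℝ E - α) - 1)) *
        ∫⁻ y in closedBall x r, f y ∂μ := by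
  set s : ℝ := Module.finrank ℝ E - α with hs
  have hS : MeasurableSet {z : E × ℝ | ‖x - z.1‖ ≤ z.2} :=
    measurableSet_le (by fun_prop) (by fun_prop)
  have h := lintegral_mul_lintegral_indicator_swap (μ := μ)
    (ν := volume.restrict (Set.Ioi (0 : ℝ))) hS hf
    (w := fun r => ENNReal.ofReal (s * r ^ (-s - 1))) (by fun_prop)
  have hball (r : ℝ) : {y | ‖x - y‖ ≤ r} = closedBall x r := by
    ext y
    simp [dist_eq_norm, norm_sub_rev]
  simp only [Set.mem_ofPred_eq, hball] at h
  rw [← h]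
  refine lintegral_mono fun y => ?_
  rw [mul_comm, show α - Module.finrank ℝ E = -s by rw [hs]; ring]
  gcongr
  exact ofReal_rpow_neg_le_lintegral (sub_pos.2 hα) (norm_nonneg _)

/-- Hedberg's pointwise inequality. -/
theorem exists_rieszPotential_le_ratMaximal {α p q : ℝ} (hα0 : 0 < α)
    (hα : α < Module.finrank ℝ E) (hp : 1 < p) (hpα : p < Module.finrank ℝ E / α)
    (hq : 1 / q = 1 / p - α / Module.finrank ℝ E) :
    ∃ K : ℝ≥0∞, K ≠ ∞ ∧ ∀ f : E → ℝ≥0∞, Measurable f → ∀ x,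
      rieszPotential μ α f x ≤
        K * (ratMaximal μ f x ^ (p / q) * ((∫⁻ y, f y ^ p ∂μ) ^ (1 / p)) ^ (1 - p / q)) := by
  set d := Module.finrank ℝ E
  have hd0 : (0 : ℝ) < d := hα0.trans hα
  have hp0 : 0 < p := by linarith
  set s : ℝ := d - α with hs
  have hs0 : 0 < s := sub_pos.2 hα
  set b : ℝ := d / p - α with hb
  have hb0 : 0 < b := by
    rw [lt_div_iff₀ hα0] at hpα
    rw [hb, sub_pos, lt_div_iff₀ hp0]
    linarith
  have hθ : b / (α + b) = p / q := by
    rw [div_eq_mul_one_div p q, hq, hb, add_sub_cancel]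
    field_simp
  have hθ' : α / (α + b) = 1 - p / q := by
    rw [← hθ]
    field_simp
    ring
  have hθ0 : 0 ≤ p / q := hθ ▸ by positivity
  have hθ1 : 0 ≤ 1 - p / q := hθ' ▸ by positivity
  set V := μ (ball (0 : E) 1)
  have hVt : V ≠ ∞ := measure_ball_lt_top.ne
  have hp1 : 0 ≤ 1 - 1 / p := sub_nonneg.2 ((div_le_one hp0).2 hp.le)
  set K₁ : ℝ≥0∞ := ENNReal.ofReal s * (ENNReal.ofReal (2 ^ d) * V)
  set K₂ : ℝ≥0∞ := ENNReal.ofReal s * V ^ (1 - 1 / p)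
  have hK₁ : K₁ ≠ ∞ := by finiteness
  have hK₂ : K₂ ≠ ∞ := ENNReal.mul_ne_top ENNReal.ofReal_ne_top
    (ENNReal.rpow_ne_top_of_nonneg hp1 hVt)
  refine ⟨ENNReal.ofReal (1 / α + 1 / b) * (K₁ ^ (p / q) * K₂ ^ (1 - p / q)),
    ENNReal.mul_ne_top ENNReal.ofReal_ne_top (ENNReal.mul_ne_top
      (ENNReal.rpow_ne_top_of_nonneg hθ0 hK₁) (ENNReal.rpow_ne_top_of_nonneg hθ1 hK₂)),
    fun f hf x => ?_⟩
  set M := ratMaximal μ f x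
  set N := (∫⁻ y, f y ^ p ∂μ) ^ (1 / p)
  have hA : ∀ r > 0, ENNReal.ofReal (s * r ^ (-s - 1)) * ∫⁻ y in closedBall x r, f y ∂μ ≤
      K₁ * M * ENNReal.ofReal (r ^ (α - 1)) := by
    intro r hr
    have e : r ^ (-s - 1) * r ^ d = r ^ (α - 1) := by
      rw [← Real.rpow_natCast, ← Real.rpow_add hr, hs]
      ring_nf
    calc _ ≤ ENNReal.ofReal (s * r ^ (-s - 1)) * (μ (closedBall x (2 * r)) * M) := by
          gcongr
          exact setLIntegral_closedBall_le_mul_ratMaximal f x hr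
      _ = _ := by
          rw [Measure.addHaar_closedBall μ x (by positivity), ← e, mul_pow,
            ENNReal.ofReal_mul hs0.le, ENNReal.ofReal_mul (by positivity),
            ENNReal.ofReal_mul (by positivity)]
          ring
  have hB : ∀ r > 0, ENNReal.ofReal (s * r ^ (-s - 1)) * ∫⁻ y in closedBall x r, f y ∂μ ≤
      K₂ * N * ENNReal.ofReal (r ^ (-b - 1)) := by
    intro r hr
    have e : r ^ (-s - 1) * (r ^ d) ^ (1 - 1 / p) = r ^ (-b - 1) := by
      rw [← Real.rpow_natCast, ← Real.rpow_mul hr.le, ← Real.rpow_add hr, hs, hb]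
      ring_nf
    calc _ ≤ ENNReal.ofReal (s * r ^ (-s - 1)) * (μ (closedBall x r) ^ (1 - 1 / p) * N) := by
          gcongr
          exact setLIntegral_le_measure_rpow_mul hp hf _
      _ = _ := by
          rw [Measure.addHaar_closedBall μ x hr.le, ← e, ENNReal.ofReal_mul hs0.le,
            ENNReal.ofReal_mul (by positivity), ENNReal.mul_rpow_of_nonneg _ _ hp1,
            ENNReal.ofReal_rpow_of_pos (by positivity)]
          ring
  calc rieszPotential μ α f x
      ≤ ENNReal.ofReal (1 / α + 1 / b) * ((K₁ * M) ^ (b / (α + b)) * (K₂ * N) ^ (α / (α + b))) :=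
        (rieszPotential_le_lintegral_closedBall hα hf x).trans
          (lintegral_Ioi_le_of_le_rpow hα0 hb0 hA hB)
    _ = _ := by
        rw [hθ, hθ', ENNReal.mul_rpow_of_nonneg _ _ hθ0, ENNReal.mul_rpow_of_nonneg _ _ hθ1]
        ring

/-- The Hardy–Littlewood–Sobolev inequality. -/
theorem exists_lintegral_rieszPotential_rpow_le {α p q : ℝ} (hα0 : 0 < α)
    (hα : α < Module.finrank ℝ E) (hp : 1 < p) (hpα : p < Module.finrank ℝ E / α)
    (hq : 1 / q = 1 / p - α / Module.finrank ℝ E) :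
    ∃ K : ℝ≥0∞, K ≠ ∞ ∧ ∀ f : E → ℝ≥0∞, Measurable f →
      (∫⁻ x, rieszPotential μ α f x ^ q ∂μ) ^ (1 / q) ≤ K * (∫⁻ x, f x ^ p ∂μ) ^ (1 / p) := by
  have hd0 : (0 : ℝ) < Module.finrank ℝ E := hα0.trans hα
  have : Nontrivial E := Module.nontrivial_of_finrank_pos (R := ℝ) (by exact_mod_cast hd0)
  have hp0 : 0 < p := by linarith
  have hq0 : 0 < q := by
    rw [← one_div_pos, hq, sub_pos, div_lt_div_iff₀ hd0 hp0]
    rw [lt_div_iff₀ hα0] at hpα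
    linarith
  have hθ0 : 0 ≤ p / q := by positivity
  have hθ1 : 0 ≤ 1 - p / q := by
    rw [div_eq_mul_one_div, hq]
    have : 0 ≤ p * (α / Module.finrank ℝ E) := by positivity
    rw [mul_sub, mul_one_div_cancel hp0.ne']
    linarith
  obtain ⟨K, hK, hpt⟩ := exists_rieszPotential_le_ratMaximal (μ := μ) hα0 hα hp hpα hq
  set D : ℝ≥0∞ := 5 ^ Module.finrank ℝ E * ENNReal.ofReal (2 * p / (p - 1)) * 2 ^ (p - 1)
  have hD : D ≠ ∞ := ENNReal.mul_ne_top (by finiteness)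
    (ENNReal.rpow_ne_top_of_nonneg (by linarith) (by norm_num))
  refine ⟨K * D ^ (1 / q), ENNReal.mul_ne_top hK
    (ENNReal.rpow_ne_top_of_nonneg (by positivity) hD), fun f hf => ?_⟩
  set N := (∫⁻ x, f x ^ p ∂μ) ^ (1 / p) with hN
  have hNp : ∫⁻ x, f x ^ p ∂μ = N ^ p := by
    rw [hN, ← ENNReal.rpow_mul, one_div_mul_cancel hp0.ne', ENNReal.rpow_one]
  have hint : ∫⁻ x, rieszPotential μ α f x ^ q ∂μ ≤
      (K * N ^ (1 - p / q)) ^ q * (D * N ^ p) := by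
    calc ∫⁻ x, rieszPotential μ α f x ^ q ∂μ
        ≤ ∫⁻ x, (K * N ^ (1 - p / q)) ^ q * ratMaximal μ f x ^ p ∂μ := by
          refine lintegral_mono fun x => ?_
          calc _ ≤ (K * (ratMaximal μ f x ^ (p / q) * N ^ (1 - p / q))) ^ q := by
                gcongr
                exact hpt f hf x
            _ = _ := by
                rw [mul_comm (ratMaximal μ f x ^ (p / q)), ← mul_assoc,
                  ENNReal.mul_rpow_of_nonneg _ _ hq0.le, ← ENNReal.rpow_mul (ratMaximal μ f x),
                  div_mul_cancel₀ _ hq0.ne']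
      _ = (K * N ^ (1 - p / q)) ^ q * ∫⁻ x, ratMaximal μ f x ^ p ∂μ :=
          lintegral_const_mul _ ((measurable_ratMaximal hf).pow_const p)
      _ ≤ _ := by
          rw [← hNp]
          gcongr
          exact lintegral_ratMaximal_rpow_le hp hf
  calc _ ≤ ((K * N ^ (1 - p / q)) ^ q * (D * N ^ p)) ^ (1 / q) := by gcongr
    _ = K * D ^ (1 / q) * (N ^ (1 - p / q) * N ^ (p / q)) := by
        rw [ENNReal.mul_rpow_of_nonneg _ _ (by positivity),
          ENNReal.mul_rpow_of_nonneg D _ (by positivity), ← ENNReal.rpow_mul,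
          mul_one_div_cancel hq0.ne', ENNReal.rpow_one, ← ENNReal.rpow_mul N p, mul_one_div]
        ring
    _ = _ := by
        rw [← ENNReal.rpow_add_of_nonneg _ _ hθ1 hθ0, sub_add_cancel, ENNReal.rpow_one]

end MaximalFunction

theorem HomogZero.exists_abs_le {n : ℕ} {Ω : EuclideanSpace ℝ (Fin n) → ℝ} (hhom : HomogZero Ω)
    (hcont : ContinuousOn Ω (sphere 0 1)) : ∃ M : ℝ, 0 < M ∧ ∀ x, x ≠ 0 → |Ω x| ≤ M := by
  obtain ⟨M, hM⟩ := (isCompact_sphere (0 : EuclideanSpace ℝ (Fin n)) 1).exists_bound_of_continuousOn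
    hcont
  refine ⟨max M 1, by positivity, fun x hx => ?_⟩
  have hx' : 0 < ‖x‖ := norm_pos_iff.2 hx
  rw [← hhom ‖x‖⁻¹ (inv_pos.2 hx') x hx]
  refine (hM _ ?_).trans (le_max_left _ _)
  rw [mem_sphere_zero_iff_norm, norm_smul, norm_inv, norm_norm, inv_mul_cancel₀ hx'.ne']

theorem ofReal_abs_fracInt_le {n : ℕ} {Ω : EuclideanSpace ℝ (Fin n) → ℝ} {M α : ℝ}
    (hM : ∀ x, x ≠ 0 → |Ω x| ≤ M) (hα : α < n) (f : EuclideanSpace ℝ (Fin n) → ℝ)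
    (x : EuclideanSpace ℝ (Fin n)) :
    ENNReal.ofReal |fracInt Ω α f x| ≤
      ENNReal.ofReal M * rieszPotential volume α (fun y => ENNReal.ofReal |f y|) x := by
  simp only [fracInt, rieszPotential, finrank_euclideanSpace_fin, ← Real.enorm_eq_ofReal_abs]
  rw [← lintegral_const_mul' _ _ ENNReal.ofReal_ne_top]
  refine (enorm_integral_le_lintegral_enorm _).trans (lintegral_mono fun y => ?_)
  simp only [enorm_mul, ← mul_assoc]
  refine mul_le_mul_left ?_ _
  rw [Real.enorm_of_nonneg (Real.rpow_nonneg (norm_nonneg _) _)]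
  rcases eq_or_ne (x - y) 0 with h | h
  · simp [h, Real.zero_rpow (sub_neg.2 hα).ne]
  · gcongr
    rw [Real.enorm_eq_ofReal_abs]
    exact ENNReal.ofReal_le_ofReal (hM _ h)

theorem statement5 (n : ℕ) (hn : 1 ≤ n) (α p q : ℝ) (hα0 : 0 < α) (hαn : α < n)
    (hp1 : 1 < p) (hp : p < n / α) (hq : 1 / q = 1 / p - α / n)
    (Ω : EuclideanSpace ℝ (Fin n) → ℝ) (hhom : HomogZero Ω) (hmean : MeanZeroOnSphere Ω)
    (L : NNReal) (hlip : LipschitzOnWith L Ω (sphere (0 : EuclideanSpace ℝ (Fin n)) 1)) :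
    ∃ C > (0 : ℝ), ∀ f : EuclideanSpace ℝ (Fin n) → ℝ, Measurable f → lpNorm p f ≠ ∞ →
      lpNorm q (fracInt Ω α f) ≤ ENNReal.ofReal C * lpNorm p f := by
  obtain ⟨M, hM0, hM⟩ := hhom.exists_abs_le hlip.continuousOn
  have hq0 : 0 < q := by
    have hn0 : (0 : ℝ) < n := hα0.trans hαn
    rw [← one_div_pos, hq, sub_pos, div_lt_div_iff₀ hn0 (by linarith)]
    rw [lt_div_iff₀ hα0] at hp
    linarith
  have hfin : (Module.finrank ℝ (EuclideanSpace ℝ (Fin n)) : ℝ) = n := by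
    rw [finrank_euclideanSpace_fin]
  obtain ⟨K, hK, hbound⟩ := exists_lintegral_rieszPotential_rpow_le
    (μ := (volume : Measure (EuclideanSpace ℝ (Fin n)))) (p := p) (q := q) hα0
    (by rwa [hfin]) hp1 (by rwa [hfin]) (by rwa [hfin])
  refine ⟨M * K.toReal + 1, by positivity, fun f hf _ => ?_⟩
  calc lpNorm q (fracInt Ω α f)
      ≤ (∫⁻ x, ENNReal.ofReal M ^ q *
          rieszPotential volume α (fun y => ENNReal.ofReal |f y|) x ^ q) ^ (1 / q) := by
        unfold _root_.lpNorm
        gcongr with x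
        rw [← ENNReal.mul_rpow_of_nonneg _ _ hq0.le]
        gcongr
        exact ofReal_abs_fracInt_le hM hαn f x
    _ = ENNReal.ofReal M * (∫⁻ x,
          rieszPotential volume α (fun y => ENNReal.ofReal |f y|) x ^ q) ^ (1 / q) := by
        rw [lintegral_const_mul' _ _ (by finiteness),
          ENNReal.mul_rpow_of_nonneg _ _ (by positivity), ← ENNReal.rpow_mul,
          mul_one_div_cancel hq0.ne', ENNReal.rpow_one]
    _ ≤ ENNReal.ofReal M * (K * lpNorm p f) := by
        gcongr
        exact hbound _ (by fun_prop)
    _ ≤ ENNReal.ofReal (M * K.toReal + 1) * lpNorm p f := by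
        rw [← mul_assoc]
        gcongr
        conv_lhs => rw [← ENNReal.ofReal_toReal hK, ← ENNReal.ofReal_mul hM0.le]
        exact ENNReal.ofReal_le_ofReal (by linarith)

end
end
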